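/- In the transductive Context-FTPL setup with predictors, fix a sequence (x^1,f^1),…,(x^T,f^T) of contexts x^t ∈ X and loss functions f^t : {0,1}^K → ℝ and predictors Q^1,…,Q^T : {0,1}^K → ℝ, and for each t let π^t be the smallest (tie-breaking order) minimizer over π ∈ Π of Σ_{τ=1}^{t−1} f^τ(π(x^τ)) + Q^t(π(x^t)) + Σ_{x ∈ X} ⟨π(x), ℓ_x⟩. Then the expected regret satisfies: E[ Σ_{t=1}^T f^t(π^t(x^t)) ] − min_{π* ∈ Π} Σ_{t=1}^T f^t(π*(x^t)) ≤ 4·ε·K·Σ_{t=1}^T ‖f^t − Q^t‖_*² + (10/ε)·√(d·m)·log N, where the expectation is over the i.i.d. Laplace(ε) perturbation. (Theorem: predictor-based (path-length) regret bound for optimistic Context-FTPL in the transductive setting, oblivious-adversary form.) -/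

import Mathlib

open MeasureTheory Finset

/-- The i.i.d. product Laplace(ε) measure on `ι → ℝ`: density
`z ↦ ∏ i (ε/2)·exp(−ε|z i|)` with respect to Lebesgue measure. -/
noncomputable def laplacePi (ι : Type*) [Fintype ι] (ε : ℝ) :
    MeasureTheory.Measure (ι → ℝ) :=
  (MeasureTheory.volume : MeasureTheory.Measure (ι → ℝ)).withDensity
    fun z => ENNReal.ofReal (∏ i, ε / 2 * Real.exp (-ε * |z i|))

/-- `⟨a, v⟩` for `a ∈ {0,1}^K` (as a Boolean vector) and `v ∈ ℝ^K`. -/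
def dotp {K : ℕ} (a : Fin K → Bool) (v : Fin K → ℝ) : ℝ :=
  ∑ j, if a j then v j else 0

/-- `‖f‖_* = max_{a ∈ {0,1}^K} |f a|` for a loss function `f`. -/
noncomputable def dualNorm {K : ℕ} (f : (Fin K → Bool) → ℝ) : ℝ :=
  Finset.univ.sup' ⟨fun _ => false, Finset.mem_univ _⟩ fun a => |f a|

/-- The smallest (in the tie-breaking linear order) minimizer of `c` over the
finite nonempty policy set `P`. -/
noncomputable def argminTie {P : Type*} [Fintype P] [Nonempty P] [LinearOrder P]
    (c : P → ℝ) : P :=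
  haveI := Classical.decPred fun p : P => ∀ q, c p ≤ c q
  (Finset.univ.filter fun p : P => ∀ q, c p ≤ c q).min' (by
    obtain ⟨p, -, hp⟩ := Finset.exists_min_image (Finset.univ : Finset P) c
      ⟨Classical.arbitrary P, Finset.mem_univ _⟩
    exact ⟨p, Finset.mem_filter.mpr ⟨Finset.mem_univ _, fun q => hp q (Finset.mem_univ q)⟩⟩)

section ArgminTie

variable {P : Type*} [Fintype P] [Nonempty P] [LinearOrder P]

theorem argminTie_le (c : P → ℝ) (q : P) : c (argminTie c) ≤ c q := by
  let _ := Classical.decPred fun p : P => ∀ q, c p ≤ c q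
  have h : argminTie c ∈ Finset.univ.filter fun p : P => ∀ q, c p ≤ c q := Finset.min'_mem _ _
  exact (Finset.mem_filter.mp h).2 q

theorem argminTie_eq_iff (c : P → ℝ) (p : P) :
    argminTie c = p ↔ ∀ q, c p ≤ c q ∧ (q < p → c p < c q) := by
  let _ := Classical.decPred fun p : P => ∀ q, c p ≤ c q
  constructor
  · rintro rfl q
    refine ⟨argminTie_le c q, fun hq => ?_⟩
    by_contra hcon
    have hmin : ∀ r, c q ≤ c r := fun r => (not_lt.mp hcon).trans (argminTie_le c r)
    refine absurd hq (not_lt.mpr ?_)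
    exact Finset.min'_le _ _ (Finset.mem_filter.mpr ⟨Finset.mem_univ _, hmin⟩)
  · intro h
    apply le_antisymm
    · exact Finset.min'_le _ _ (Finset.mem_filter.mpr ⟨Finset.mem_univ _, fun q => (h q).1⟩)
    · by_contra hlt
      exact absurd (argminTie_le c p) (not_le.mpr ((h _).2 (not_le.mp hlt)))

theorem measurableSet_argminTie_eq {Ω : Type*} [MeasurableSpace Ω] {c : Ω → P → ℝ}
    (hc : ∀ p, Measurable fun ω => c ω p) (p : P) :
    MeasurableSet {ω | argminTie (c ω) = p} := by
  simp only [argminTie_eq_iff, Set.ofPred_forall]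
  refine MeasurableSet.iInter fun q => (measurableSet_le (hc p) (hc q)).inter ?_
  change MeasurableSet {ω | q < p → c ω p < c ω q}
  by_cases hq : q < p
  · simpa only [hq, true_imp_iff] using measurableSet_lt (hc p) (hc q)
  · simp only [hq, false_imp_iff, Set.ofPred_true, MeasurableSet.univ]

theorem measurable_comp_argminTie {Ω : Type*} [MeasurableSpace Ω] {c : Ω → P → ℝ}
    (hc : ∀ p, Measurable fun ω => c ω p) (F : P → ℝ) :
    Measurable fun ω => F (argminTie (c ω)) := by
  let _ : MeasurableSpace P := ⊤
  have h : Measurable fun ω => argminTie (c ω) :=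
    measurable_to_countable' fun p => measurableSet_argminTie_eq hc p
  exact (measurable_of_countable F).comp h

theorem integrable_comp_argminTie {Ω : Type*} [MeasurableSpace Ω] (μ : Measure Ω)
    [IsFiniteMeasure μ] {c : Ω → P → ℝ}
    (hc : ∀ p, Measurable fun ω => c ω p) (F : P → ℝ) :
    Integrable (fun ω => F (argminTie (c ω))) μ := by
  refine Integrable.of_bound (measurable_comp_argminTie hc F).aestronglyMeasurable
    (∑ p, |F p|) (Filter.Eventually.of_forall fun ω => ?_)
  exact Finset.single_le_sum (f := fun p => |F p|) (fun _ _ => abs_nonneg _) (Finset.mem_univ _)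

theorem integral_comp_argminTie {Ω : Type*} [MeasurableSpace Ω] (μ : Measure Ω)
    [IsFiniteMeasure μ] {c : Ω → P → ℝ}
    (hc : ∀ p, Measurable fun ω => c ω p) (F : P → ℝ) :
    ∫ ω, F (argminTie (c ω)) ∂μ = ∑ p, F p * μ.real {ω | argminTie (c ω) = p} := by
  classical
  have h : ∀ ω, F (argminTie (c ω)) =
      ∑ p, Set.indicator {ω | argminTie (c ω) = p} (fun _ => F p) ω := by
    intro ω
    simp [Set.indicator_apply]
  simp_rw [h]
  rw [integral_finsetSum]
  · refine Finset.sum_congr rfl fun p _ => ?_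
    rw [integral_indicator_const _ (measurableSet_argminTie_eq hc p), smul_eq_mul, mul_comm]
  · intro p _
    exact (integrable_const _).indicator (measurableSet_argminTie_eq hc p)

/-- Be-the-leader with predictions: `π t` leads after the prediction `H t` is revealed and `ρ t`
leads after `F t` is revealed. -/
theorem be_the_leader_optimistic {P : Type*} (F H : ℕ → P → ℝ) (R : P → ℝ) (π ρ : ℕ → P) (r : P)
    (hr : ∀ q, R r ≤ R q)
    (hπ : ∀ t q, (∑ τ ∈ range t, F τ (π t)) + H t (π t) + R (π t) ≤
      (∑ τ ∈ range t, F τ q) + H t q + R q)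
    (hρ : ∀ t q, (∑ τ ∈ range t, F τ (ρ t)) + F t (ρ t) + R (ρ t) ≤
      (∑ τ ∈ range t, F τ q) + F t q + R q) (T : ℕ) (p : P) :
    (∑ t ∈ range T, (H t (π t) + (F t (ρ t) - H t (ρ t)))) + R r ≤
      (∑ t ∈ range T, F t p) + R p := by
  induction T generalizing p with
  | zero => simpa using hr p
  | succ T ih =>
    rw [sum_range_succ, sum_range_succ]
    linarith [ih (π T), hπ T (ρ T), hρ T p]

end ArgminTie

section Laplace

variable {ι : Type*} [Fintype ι] {ε : ℝ}

theorem integrable_exp_neg_abs_add {b : ℝ} (hb : |b| < ε) :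
    Integrable fun x : ℝ => ε / 2 * Real.exp (-ε * |x|) * Real.exp (b * x) := by
  obtain ⟨h1, h2⟩ := abs_lt.mp hb
  rw [← integrableOn_univ, ← Set.Iic_union_Ioi (a := (0 : ℝ))]
  refine IntegrableOn.union ?_ ?_
  · refine IntegrableOn.congr_fun
      ((integrableOn_exp_mul_Iic (a := ε + b) (by linarith) 0).const_mul (ε / 2)) (fun x hx => ?_) measurableSet_Iic
    simp only [abs_of_nonpos (Set.mem_Iic.mp hx), mul_assoc, ← Real.exp_add]
    ring_nf
  · refine IntegrableOn.congr_fun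
      ((integrableOn_exp_mul_Ioi (a := b - ε) (by linarith) 0).const_mul (ε / 2)) (fun x hx => ?_) measurableSet_Ioi
    simp only [abs_of_pos (Set.mem_Ioi.mp hx), mul_assoc, ← Real.exp_add]
    ring_nf

/-- The moment generating function of the Laplace distribution. -/
theorem integral_exp_neg_abs_add {b : ℝ} (hb : |b| < ε) :
    ∫ x : ℝ, ε / 2 * Real.exp (-ε * |x|) * Real.exp (b * x) = (1 - (b / ε) ^ 2)⁻¹ := by
  have hε : 0 < ε := (abs_nonneg b).trans_lt hb
  obtain ⟨h1, h2⟩ := abs_lt.mp hb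
  have hI := integrable_exp_neg_abs_add hb
  rw [← intervalIntegral.integral_Iic_add_Ioi (b := 0) hI.integrableOn hI.integrableOn]
  have e1 : ∫ x in Set.Iic (0 : ℝ), ε / 2 * Real.exp (-ε * |x|) * Real.exp (b * x) =
      ∫ x in Set.Iic (0 : ℝ), ε / 2 * Real.exp ((ε + b) * x) := by
    refine setIntegral_congr_fun measurableSet_Iic fun x hx => ?_
    simp only [abs_of_nonpos (Set.mem_Iic.mp hx), mul_assoc, ← Real.exp_add]
    ring_nf
  have e2 : ∫ x in Set.Ioi (0 : ℝ), ε / 2 * Real.exp (-ε * |x|) * Real.exp (b * x) =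
      ∫ x in Set.Ioi (0 : ℝ), ε / 2 * Real.exp ((b - ε) * x) := by
    refine setIntegral_congr_fun measurableSet_Ioi fun x hx => ?_
    simp only [abs_of_pos (Set.mem_Ioi.mp hx), mul_assoc, ← Real.exp_add]
    ring_nf
  rw [e1, e2, integral_const_mul, integral_const_mul, integral_exp_mul_Iic (by linarith),
    integral_exp_mul_Ioi (by linarith)]
  have h3 : ε + b ≠ 0 := by linarith
  have h4 : b - ε ≠ 0 := by linarith
  have h5 : 1 - (b / ε) ^ 2 = (ε + b) * (ε - b) / ε ^ 2 := by field_simp; ring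
  have h6 : ε - b ≠ 0 := by linarith
  have h7 : b - ε = -(ε - b) := by ring
  rw [h5, h7]
  simp only [mul_zero, Real.exp_zero]
  field_simp
  ring

theorem laplace_density_nonneg (hε : 0 < ε) (z : ι → ℝ) :
    0 ≤ ∏ i, ε / 2 * Real.exp (-ε * |z i|) :=
  Finset.prod_nonneg fun _ _ => by positivity

theorem measurable_laplace_density :
    Measurable fun z : ι → ℝ => ENNReal.ofReal (∏ i, ε / 2 * Real.exp (-ε * |z i|)) := by
  fun_prop

theorem integral_laplacePi (hε : 0 < ε) (h : (ι → ℝ) → ℝ) :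
    ∫ z, h z ∂laplacePi ι ε = ∫ z, (∏ i, ε / 2 * Real.exp (-ε * |z i|)) * h z := by
  rw [laplacePi, integral_withDensity_eq_integral_toReal_smul measurable_laplace_density
    (Filter.Eventually.of_forall fun _ => ENNReal.ofReal_lt_top)]
  simp only [ENNReal.toReal_ofReal (laplace_density_nonneg hε _), smul_eq_mul]

theorem integrable_laplacePi_iff (hε : 0 < ε) (h : (ι → ℝ) → ℝ) :
    Integrable h (laplacePi ι ε) ↔
      Integrable fun z => (∏ i, ε / 2 * Real.exp (-ε * |z i|)) * h z := by
  rw [laplacePi, integrable_withDensity_iff_integrable_smul' measurable_laplace_density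
    (Filter.Eventually.of_forall fun _ => ENNReal.ofReal_lt_top)]
  simp only [ENNReal.toReal_ofReal (laplace_density_nonneg hε _), smul_eq_mul]

theorem laplace_density_mul_exp (b z : ι → ℝ) :
    (∏ i, ε / 2 * Real.exp (-ε * |z i|)) * Real.exp (∑ i, b i * z i) =
      ∏ i, ε / 2 * Real.exp (-ε * |z i|) * Real.exp (b i * z i) := by
  rw [Real.exp_sum, ← Finset.prod_mul_distrib]

theorem integrable_exp_laplacePi (hε : 0 < ε) {b : ι → ℝ} (hb : ∀ i, |b i| < ε) :
    Integrable (fun z => Real.exp (∑ i, b i * z i)) (laplacePi ι ε) := by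
  rw [integrable_laplacePi_iff hε]
  simp_rw [laplace_density_mul_exp]
  exact Integrable.fintype_prod
    (f := fun i x => ε / 2 * Real.exp (-ε * |x|) * Real.exp (b i * x))
    fun i => integrable_exp_neg_abs_add (hb i)

theorem integral_exp_laplacePi (hε : 0 < ε) {b : ι → ℝ} (hb : ∀ i, |b i| < ε) :
    ∫ z, Real.exp (∑ i, b i * z i) ∂laplacePi ι ε = ∏ i, (1 - (b i / ε) ^ 2)⁻¹ := by
  rw [integral_laplacePi hε]
  simp_rw [laplace_density_mul_exp]
  rw [integral_fintype_prod_volume_eq_prod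
    (f := fun i x => ε / 2 * Real.exp (-ε * |x|) * Real.exp (b i * x))]
  exact Finset.prod_congr rfl fun i _ => integral_exp_neg_abs_add (hb i)

theorem isProbabilityMeasure_laplacePi (hε : 0 < ε) : IsProbabilityMeasure (laplacePi ι ε) := by
  have h0 : ∀ i : ι, |(0 : ι → ℝ) i| < ε := fun i => by simpa using hε
  have hI := integrable_exp_laplacePi hε h0
  have h1 := integral_exp_laplacePi hε h0
  simp only [Pi.zero_apply, zero_mul, Finset.sum_const_zero, Real.exp_zero] at hI h1
  simp only [integral_const, smul_eq_mul, mul_one, zero_div, ne_eq, OfNat.ofNat_ne_zero,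
    not_false_eq_true, zero_pow, sub_zero, inv_one, Finset.prod_const_one] at h1
  refine ⟨?_⟩
  rw [measureReal_def] at h1
  exact (ENNReal.toReal_eq_one_iff _).mp h1

theorem laplacePi_le_of_shift (hε : 0 < ε) (s : ι → ℝ) {S S' : Set (ι → ℝ)}
    (hS : MeasurableSet S) (hS' : MeasurableSet S') (h : ∀ z ∈ S, z + s ∈ S') :
    laplacePi ι ε S ≤ ENNReal.ofReal (Real.exp (ε * ∑ i, |s i|)) * laplacePi ι ε S' := by
  set w : (ι → ℝ) → ENNReal := fun z => ENNReal.ofReal (∏ i, ε / 2 * Real.exp (-ε * |z i|)) with hw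
  have key : ∀ z, w z ≤ ENNReal.ofReal (Real.exp (ε * ∑ i, |s i|)) * w (z + s) := by
    intro z
    rw [hw, ← ENNReal.ofReal_mul (Real.exp_nonneg _)]
    refine ENNReal.ofReal_le_ofReal ?_
    rw [Finset.mul_sum, Real.exp_sum, ← Finset.prod_mul_distrib]
    refine Finset.prod_le_prod (fun _ _ => by positivity) fun i _ => ?_
    rw [mul_left_comm, ← Real.exp_add]
    gcongr
    have := mul_le_mul_of_nonneg_left (abs_add_le (z i) (s i)) hε.le
    simp only [Pi.add_apply]
    linarith
  have hSw : laplacePi ι ε S = ∫⁻ z, S.indicator w z := by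
    rw [laplacePi, withDensity_apply _ hS, lintegral_indicator hS]
  have hSw' : laplacePi ι ε S' = ∫⁻ z, S'.indicator w z := by
    rw [laplacePi, withDensity_apply _ hS', lintegral_indicator hS']
  rw [hSw, hSw', ← lintegral_add_right_eq_self (S'.indicator w) s,
    ← lintegral_const_mul' _ _ ENNReal.ofReal_ne_top]
  refine lintegral_mono fun z => ?_
  by_cases hz : z ∈ S
  · rw [Set.indicator_of_mem hz, Set.indicator_of_mem (h z hz)]
    exact key z
  · rw [Set.indicator_of_notMem hz]
    exact zero_le

theorem inv_one_sub_le_exp {u : ℝ} (hu : u ≤ 1 / 4) (hu0 : 0 ≤ u) :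
    (1 - u)⁻¹ ≤ Real.exp (4 / 3 * u) := by
  have h1 : (1 - u)⁻¹ ≤ 4 / 3 * u + 1 := by
    rw [inv_le_iff_one_le_mul₀ (by linarith)]
    nlinarith
  exact h1.trans (Real.add_one_le_exp _)

theorem integral_exp_laplacePi_le (hε : 0 < ε) {b : ι → ℝ} (hb : ∀ i, |b i| ≤ ε / 2) :
    ∫ z, Real.exp (∑ i, b i * z i) ∂laplacePi ι ε ≤
      Real.exp (4 / 3 * ((∑ i, b i ^ 2) / ε ^ 2)) := by
  rw [integral_exp_laplacePi hε fun i => (hb i).trans_lt (by linarith), Finset.sum_div,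
    Finset.mul_sum, Real.exp_sum]
  have hu : ∀ i, (b i / ε) ^ 2 ≤ 1 / 4 := fun i => by
    have : |b i / ε| ≤ 1 / 2 := by
      rw [abs_div, abs_of_pos hε, div_le_iff₀ hε]
      linarith [hb i]
    rw [← sq_abs]
    nlinarith [abs_nonneg (b i / ε)]
  refine Finset.prod_le_prod (fun i _ => inv_nonneg.mpr (by linarith [hu i])) fun i _ => ?_
  rw [← div_pow]
  exact inv_one_sub_le_exp (hu i) (sq_nonneg _)

end Laplace

section Policies

variable {X P : Type*} [Fintype X] {K : ℕ}

theorem sum_dotp_eq (a : X → Fin K → Bool) (z : X × Fin K → ℝ) :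
    ∑ x, dotp (a x) (fun j => z (x, j)) = ∑ i : X × Fin K, (if a i.1 i.2 then 1 else 0) * z i := by
  simp only [dotp, Fintype.sum_prod_type, ite_mul, one_mul, zero_mul]

theorem measurable_sum_dotp (a : X → Fin K → Bool) :
    Measurable fun z : X × Fin K → ℝ => ∑ x, dotp (a x) (fun j => z (x, j)) := by
  simp_rw [sum_dotp_eq]
  fun_prop

theorem abs_le_dualNorm (g : (Fin K → Bool) → ℝ) (a : Fin K → Bool) : |g a| ≤ dualNorm g :=
  Finset.le_sup' (fun a => |g a|) (Finset.mem_univ a)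

theorem dualNorm_nonneg (g : (Fin K → Bool) → ℝ) : 0 ≤ dualNorm g :=
  (abs_nonneg _).trans (abs_le_dualNorm g fun _ => false)

theorem dotp_add (a : Fin K → Bool) (v w : Fin K → ℝ) : dotp a (v + w) = dotp a v + dotp a w := by
  simp only [dotp, ← Finset.sum_add_distrib, Pi.add_apply]
  exact Finset.sum_congr rfl fun j _ => by split_ifs <;> simp

/-- The vector rewarding agreement with `a` by `-c` per coordinate separates `a` from every other
action by at least `c`. -/
theorem dotp_add_le_of_ne {a b : Fin K → Bool} (hab : b ≠ a) {c : ℝ} (hc : 0 ≤ c) :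
    dotp a (fun j => if a j then -c else c) + c ≤ dotp b (fun j => if a j then -c else c) := by
  obtain ⟨j, hj⟩ := Function.ne_iff.mp hab
  rw [← le_sub_iff_add_le']
  simp only [dotp, ← Finset.sum_sub_distrib]
  have hterm : ∀ i, 0 ≤ (if b i then (if a i then -c else c) else 0) -
      (if a i then (if a i then -c else c) else 0) := fun i => by
    split_ifs <;> linarith
  refine le_trans ?_ (Finset.single_le_sum (fun i _ => hterm i) (Finset.mem_univ j))
  cases ha : a j <;> cases hb : b j <;> simp_all

variable [Fintype P] [Nonempty P] [LinearOrder P] {ε : ℝ}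

/-- Adding a loss `g` at context `x₀` changes the law of the perturbed leader by a factor at most
`exp (2 ε K ‖g‖)`. -/
theorem measureReal_argminTie_le (hε : 0 < ε) (pol : P → X → Fin K → Bool) (C : P → ℝ) (x₀ : X)
    (g : (Fin K → Bool) → ℝ) (p : P) :
    (laplacePi (X × Fin K) ε).real
        {z | argminTie (fun q => C q + ∑ x, dotp (pol q x) fun j => z (x, j)) = p} ≤
      Real.exp (2 * ε * K * dualNorm g) * (laplacePi (X × Fin K) ε).real
        {z | argminTie (fun q => C q + g (pol q x₀) + ∑ x, dotp (pol q x) fun j => z (x, j)) =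
          p} := by
  classical
  have := isProbabilityMeasure_laplacePi (ι := X × Fin K) hε
  set G := dualNorm g
  have hG0 : 0 ≤ G := dualNorm_nonneg g
  set v : Fin K → ℝ := fun j => if pol p x₀ j then -(2 * G) else 2 * G with hv
  set s : X × Fin K → ℝ := fun i => if i.1 = x₀ then v i.2 else 0 with hs
  have hs_sum : ∑ i, |s i| = 2 * G * K := by
    have h1 : ∀ j, |v j| = 2 * G := fun j => by
      simp only [hv]; split_ifs <;> simp [abs_of_nonneg hG0]
    have h2 : ∀ i, |s i| = if i.1 = x₀ then 2 * G else 0 := fun i => by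
      simp only [hs]; split_ifs <;> simp [h1]
    simp_rw [h2, Fintype.sum_prod_type]
    simp [mul_comm]
  have hshift : ∀ (z : X × Fin K → ℝ) q, ∑ x, dotp (pol q x) (fun j => (z + s) (x, j)) =
      (∑ x, dotp (pol q x) fun j => z (x, j)) + dotp (pol q x₀) v := by
    intro z q
    have h1 : ∀ x, dotp (pol q x) (fun j => (z + s) (x, j)) =
        dotp (pol q x) (fun j => z (x, j)) + if x = x₀ then dotp (pol q x) v else 0 := by
      intro x
      have h2 := dotp_add (pol q x) (fun j => z (x, j)) (fun j => s (x, j))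
      refine h2.trans ?_
      congr 1
      simp only [hs]
      split_ifs
      · rfl
      · simp [dotp]
    simp_rw [h1, Finset.sum_add_distrib]
    simp
  have hmeas : ∀ D : P → ℝ, MeasurableSet {z : X × Fin K → ℝ |
      argminTie (fun q => D q + ∑ x, dotp (pol q x) fun j => z (x, j)) = p} := fun D =>
    measurableSet_argminTie_eq (fun q => (measurable_sum_dotp (pol q)).const_add _) p
  have hle := laplacePi_le_of_shift hε s (hmeas C) (hmeas fun q => C q + g (pol q x₀)) ?_
  · have h := ENNReal.toReal_mono (by finiteness) hle
    rw [ENNReal.toReal_mul, ENNReal.toReal_ofReal (Real.exp_nonneg _), hs_sum] at h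
    rwa [show ε * (2 * G * K) = 2 * ε * K * G by ring] at h
  · intro z hz
    simp only [Set.mem_ofPred_eq, argminTie_eq_iff, hshift] at hz ⊢
    intro q
    obtain ⟨h1, h2⟩ := hz q
    by_cases hq : pol q x₀ = pol p x₀
    · rw [hq]
      exact ⟨by linarith, fun hlt => by linarith [h2 hlt]⟩
    · have h3 : dotp (pol p x₀) v + 2 * G ≤ dotp (pol q x₀) v :=
        dotp_add_le_of_ne hq (by positivity)
      have h4 := (abs_le.mp (abs_le_dualNorm g (pol p x₀))).2
      have h5 := (abs_le.mp (abs_le_dualNorm g (pol q x₀))).1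
      exact ⟨by linarith, fun hlt => by linarith [h2 hlt]⟩

/-- Stability of the perturbed leader under adding a loss `g` at context `x₀`. -/
theorem integral_argminTie_sub_le (hε : 0 < ε) (pol : P → X → Fin K → Bool) (C : P → ℝ) (x₀ : X)
    (g : (Fin K → Bool) → ℝ) :
    ∫ z, g (pol (argminTie fun q => C q + ∑ x, dotp (pol q x) fun j => z (x, j)) x₀)
        ∂laplacePi (X × Fin K) ε -
      ∫ z, g (pol (argminTie fun q => C q + g (pol q x₀) +
        ∑ x, dotp (pol q x) fun j => z (x, j)) x₀) ∂laplacePi (X × Fin K) ε ≤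
      4 * ε * K * dualNorm g ^ 2 := by
  have := isProbabilityMeasure_laplacePi (ι := X × Fin K) hε
  have hc : ∀ (D : P → ℝ) q, Measurable fun z : X × Fin K → ℝ =>
      D q + ∑ x, dotp (pol q x) fun j => z (x, j) :=
    fun D q => (measurable_sum_dotp (pol q)).const_add _
  have hone : ∀ D : P → ℝ, ∑ p, (laplacePi (X × Fin K) ε).real
      {z | argminTie (fun q => D q + ∑ x, dotp (pol q x) fun j => z (x, j)) = p} = 1 := by
    intro D
    have h := integral_comp_argminTie (laplacePi (X × Fin K) ε) (hc D) fun _ => 1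
    simpa using h.symm
  rw [integral_comp_argminTie _ (hc C) fun p => g (pol p x₀),
    integral_comp_argminTie _ (hc fun q => C q + g (pol q x₀)) fun p => g (pol p x₀)]
  set A : P → ℝ := fun p => (laplacePi (X × Fin K) ε).real
    {z | argminTie (fun q => C q + ∑ x, dotp (pol q x) fun j => z (x, j)) = p}
  set B : P → ℝ := fun p => (laplacePi (X × Fin K) ε).real
    {z | argminTie (fun q => C q + g (pol q x₀) + ∑ x, dotp (pol q x) fun j => z (x, j)) = p}
  have hA1 : ∑ p, A p = 1 := hone C
  have hB1 : ∑ p, B p = 1 := hone fun q => C q + g (pol q x₀)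
  set G := dualNorm g
  have hG0 : 0 ≤ G := dualNorm_nonneg g
  set θ := 2 * ε * K * G with hθ
  have hAB : ∀ p, A p - B p ≤ θ * A p := by
    intro p
    have h1 : A p ≤ Real.exp θ * B p := measureReal_argminTie_le hε pol C x₀ g p
    have h2 : (1 - θ) * A p ≤ Real.exp (-θ) * A p :=
      mul_le_mul_of_nonneg_right (Real.one_sub_le_exp_neg θ) measureReal_nonneg
    have h3 : Real.exp (-θ) * A p ≤ Real.exp (-θ) * (Real.exp θ * B p) :=
      mul_le_mul_of_nonneg_left h1 (Real.exp_nonneg _)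
    rw [← mul_assoc, ← Real.exp_add, neg_add_cancel, Real.exp_zero, one_mul] at h3
    linarith
  calc ∑ p, g (pol p x₀) * A p - ∑ p, g (pol p x₀) * B p
      = ∑ p, (g (pol p x₀) + G) * (A p - B p) := by
        simp only [add_mul, mul_sub, Finset.sum_add_distrib, Finset.sum_sub_distrib,
          ← Finset.mul_sum, hA1, hB1]
        ring
    _ ≤ ∑ p, 2 * G * θ * A p := by
        refine Finset.sum_le_sum fun p _ => ?_
        obtain ⟨h1, h2⟩ := abs_le.mp (abs_le_dualNorm g (pol p x₀))
        have hA0 : 0 ≤ A p := measureReal_nonneg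
        have hθ0 : 0 ≤ θ := by positivity
        calc (g (pol p x₀) + G) * (A p - B p) ≤ (g (pol p x₀) + G) * (θ * A p) :=
              mul_le_mul_of_nonneg_left (hAB p) (by linarith)
          _ ≤ (2 * G) * (θ * A p) := by gcongr; linarith
          _ = _ := by ring
    _ = 4 * ε * K * G ^ 2 := by rw [← Finset.mul_sum, hA1, hθ]; ring

theorem sum_sq_indicator_sub_le {m : ℕ} {a b : X → Fin K → Bool}
    (ha : ∀ x, (Finset.univ.filter fun j => a x j = true).card ≤ m)
    (hb : ∀ x, (Finset.univ.filter fun j => b x j = true).card ≤ m) :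
    ∑ i : X × Fin K, (((if a i.1 i.2 then 1 else 0) - if b i.1 i.2 then 1 else 0 : ℝ)) ^ 2 ≤
      2 * (Fintype.card X * m) := by
  have hcount : ∀ c : X → Fin K → Bool,
      (∀ x, (Finset.univ.filter fun j => c x j = true).card ≤ m) →
      ∑ i : X × Fin K, (if c i.1 i.2 then 1 else 0 : ℝ) ≤ Fintype.card X * m := by
    intro c hc
    rw [Fintype.sum_prod_type, ← nsmul_eq_mul, ← Finset.card_univ]
    refine Finset.sum_le_card_nsmul _ _ _ fun x _ => ?_
    rw [Finset.sum_boole]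
    exact_mod_cast hc x
  rw [two_mul]
  refine le_trans ?_ (add_le_add (hcount a ha) (hcount b hb))
  rw [← Finset.sum_add_distrib]
  exact Finset.sum_le_sum fun i _ => by split_ifs <;> norm_num

/-- The exponential moment of a difference of two perturbations. -/
theorem integral_exp_dotp_sub_le {m : ℕ} {a b : X → Fin K → Bool} (hε : 0 < ε)
    (ha : ∀ x, (Finset.univ.filter fun j => a x j = true).card ≤ m)
    (hb : ∀ x, (Finset.univ.filter fun j => b x j = true).card ≤ m)
    {l : ℝ} (hl0 : 0 ≤ l) (hl : l ≤ ε / 2) :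
    Integrable (fun z => Real.exp (l * ((∑ x, dotp (a x) fun j => z (x, j)) -
      ∑ x, dotp (b x) fun j => z (x, j)))) (laplacePi (X × Fin K) ε) ∧
    ∫ z, Real.exp (l * ((∑ x, dotp (a x) fun j => z (x, j)) -
      ∑ x, dotp (b x) fun j => z (x, j))) ∂laplacePi (X × Fin K) ε ≤
      Real.exp (8 / 3 * (l ^ 2 * (Fintype.card X * m) / ε ^ 2)) := by
  set c : X × Fin K → ℝ := fun i =>
    l * ((if a i.1 i.2 then 1 else 0) - if b i.1 i.2 then 1 else 0) with hc
  have hlin : ∀ z : X × Fin K → ℝ, l * ((∑ x, dotp (a x) fun j => z (x, j)) -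
      ∑ x, dotp (b x) fun j => z (x, j)) = ∑ i, c i * z i := by
    intro z
    rw [sum_dotp_eq, sum_dotp_eq, ← Finset.sum_sub_distrib, Finset.mul_sum]
    exact Finset.sum_congr rfl fun i _ => by rw [hc]; ring
  have hcb : ∀ i, |c i| ≤ ε / 2 := by
    intro i
    refine le_trans ?_ hl
    simp only [hc]
    split_ifs <;> simp [abs_of_nonneg hl0, hl0]
  simp_rw [hlin]
  refine ⟨integrable_exp_laplacePi hε fun i => (hcb i).trans_lt (by linarith),
    (integral_exp_laplacePi_le hε hcb).trans (Real.exp_le_exp.mpr ?_)⟩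
  have hsum : ∑ i, c i ^ 2 ≤ l ^ 2 * (2 * (Fintype.card X * m)) := by
    simp only [hc, mul_pow, ← Finset.mul_sum]
    exact mul_le_mul_of_nonneg_left (sum_sq_indicator_sub_le ha hb) (sq_nonneg l)
  calc 4 / 3 * ((∑ i, c i ^ 2) / ε ^ 2)
      ≤ 4 / 3 * (l ^ 2 * (2 * (Fintype.card X * m)) / ε ^ 2) := by gcongr
    _ = _ := by ring

end Policies

theorem le_of_exp_sum {P : Type*} [Fintype P] {l : ℝ} (hl : 0 < l) (c : ℝ) (y : P → ℝ) (r : P) :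
    y r ≤ l⁻¹ * (c - 1 + Real.exp (-c) * ∑ q, Real.exp (l * y q)) := by
  rw [le_inv_mul_iff₀ hl]
  have h1 : Real.exp (l * y r) ≤ ∑ q, Real.exp (l * y q) :=
    Finset.single_le_sum (f := fun q => Real.exp (l * y q)) (fun _ _ => Real.exp_nonneg _)
      (Finset.mem_univ r)
  have h2 := mul_le_mul_of_nonneg_left h1 (Real.exp_nonneg (-c))
  rw [← Real.exp_add] at h2
  linarith [Real.add_one_le_exp (-c + l * y r)]

/-- **Predictor-based (path-length) regret bound for optimistic Context-FTPL,
transductive setting (oblivious-adversary form).**  With `π^t` the tie-broken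
minimizer of `∑_{τ<t} f^τ(p(x^τ)) + Q^t(p(x^t)) + ∑_x ⟨p(x), ℓ_x⟩` under the
same i.i.d. Laplace(ε) perturbation at every round, the expected regret is at
most `4·ε·K·∑_t ‖f^t − Q^t‖_*² + (10/ε)·√(dm)·log N`. -/
theorem optimistic_context_ftpl_regret_transductive
    {X P : Type*} [Fintype X] [Fintype P] [Nonempty P] [LinearOrder P]
    {K m d N : ℕ} (hK : 1 ≤ K) (hm : 1 ≤ m)
    (hd : Fintype.card X = d) (hN : Fintype.card P = N) (hN2 : 2 ≤ N)
    (pol : P → X → Fin K → Bool)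
    (hsparse : ∀ p x, (Finset.univ.filter fun j => pol p x j = true).card ≤ m)
    {ε : ℝ} (hε : 0 < ε)
    (T : ℕ) (xs : ℕ → X) (f Q : ℕ → (Fin K → Bool) → ℝ) :
    (∫ z, (∑ t ∈ Finset.range T,
          f t (pol (argminTie fun p : P =>
            (∑ τ ∈ Finset.range t, f τ (pol p (xs τ))) + Q t (pol p (xs t)) +
              ∑ xc : X, dotp (pol p xc) fun j => z (xc, j)) (xs t)))
        ∂(laplacePi (X × Fin K) ε)) -
      (Finset.univ.inf' Finset.univ_nonempty fun p : P =>
        ∑ t ∈ Finset.range T, f t (pol p (xs t))) ≤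
      4 * ε * (K : ℝ) * (∑ t ∈ Finset.range T, dualNorm (fun a => f t a - Q t a) ^ 2) +
        10 / ε * Real.sqrt ((d : ℝ) * (m : ℝ)) * Real.log N := by
  have hprob := isProbabilityMeasure_laplacePi (ι := X × Fin K) hε
  set μ := laplacePi (X × Fin K) ε with hμ
  obtain ⟨p, -, hp⟩ := Finset.exists_mem_eq_inf' (Finset.univ_nonempty (α := P))
    fun p : P => ∑ t ∈ Finset.range T, f t (pol p (xs t))
  rw [hp]
  set R : (X × Fin K → ℝ) → P → ℝ := fun z q => ∑ x, dotp (pol q x) fun j => z (x, j) with hR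
  set C : ℕ → P → ℝ := fun t q =>
    (∑ τ ∈ Finset.range t, f τ (pol q (xs τ))) + Q t (pol q (xs t)) with hC
  set g : ℕ → (Fin K → Bool) → ℝ := fun t a => f t a - Q t a with hg
  set lead : ℕ → (X × Fin K → ℝ) → P := fun t z => argminTie fun q => C t q + R z q with hlead
  set lead' : ℕ → (X × Fin K → ℝ) → P := fun t z =>
    argminTie fun q => C t q + g t (pol q (xs t)) + R z q with hlead'
  have hd1 : (1 : ℝ) ≤ Fintype.card X := by
    exact_mod_cast Fintype.card_pos_iff.mpr ⟨xs 0⟩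
  have hm1 : (1 : ℝ) ≤ m := by exact_mod_cast hm
  set n : ℝ := Fintype.card X * m with hn
  have hn1 : 1 ≤ n := one_le_mul_of_one_le_of_one_le hd1 hm1
  have hsq1 : 1 ≤ √n := Real.one_le_sqrt.mpr hn1
  have hsq : √n ^ 2 = n := Real.sq_sqrt (by linarith)
  set l : ℝ := ε / (2 * √n) with hl
  have hl0 : 0 < l := by positivity
  have hl2 : l ≤ ε / 2 := by
    rw [hl]
    gcongr
    linarith
  set c : ℝ := Real.log N + 2 / 3 with hc
  have hexp : ∀ q, Integrable (fun z => Real.exp (l * (R z p - R z q))) μ ∧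
      ∫ z, Real.exp (l * (R z p - R z q)) ∂μ ≤ Real.exp (2 / 3) := by
    intro q
    have h := integral_exp_dotp_sub_le hε (hsparse p) (hsparse q) hl0.le hl2
    refine ⟨h.1, h.2.trans_eq (congrArg Real.exp ?_)⟩
    rw [← hn, hl, div_pow, mul_pow, hsq]
    field_simp
    norm_num
  set W : (X × Fin K → ℝ) → ℝ := fun z =>
    l⁻¹ * (c - 1 + Real.exp (-c) * ∑ q, Real.exp (l * (R z p - R z q))) with hW
  have hWsum : Integrable (fun z => ∑ q, Real.exp (l * (R z p - R z q))) μ :=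
    integrable_finsetSum _ fun q _ => (hexp q).1
  have hWi : Integrable W μ := ((integrable_const _).add (hWsum.const_mul _)).const_mul _
  have hWle : ∫ z, W z ∂μ ≤ 10 / ε * √n * Real.log N := by
    have hN0 : (0 : ℝ) < N := by exact_mod_cast (by omega : 0 < N)
    have h1 : ∫ z, ∑ q, Real.exp (l * (R z p - R z q)) ∂μ ≤ Real.exp c := by
      rw [integral_finsetSum _ fun q _ => (hexp q).1, hc, Real.exp_add, Real.exp_log hN0, ← hN,
        ← nsmul_eq_mul, ← Finset.card_univ]
      exact Finset.sum_le_card_nsmul _ _ _ fun q _ => (hexp q).2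
    have h2 : ∫ z, W z ∂μ ≤ l⁻¹ * c := by
      rw [hW, integral_const_mul, integral_add (integrable_const _) (hWsum.const_mul _),
        integral_const_mul, integral_const, probReal_univ, one_smul]
      refine mul_le_mul_of_nonneg_left ?_ (inv_nonneg.mpr hl0.le)
      have h3 := mul_le_mul_of_nonneg_left h1 (Real.exp_nonneg (-c))
      rw [← Real.exp_add, neg_add_cancel, Real.exp_zero] at h3
      linarith
    have hlog : Real.log 2 ≤ Real.log N :=
      Real.log_le_log (by norm_num) (by exact_mod_cast hN2)
    have hcl : c ≤ 5 * Real.log N := by linarith [Real.log_two_gt_d9]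
    calc ∫ z, W z ∂μ ≤ l⁻¹ * c := h2
      _ ≤ l⁻¹ * (5 * Real.log N) := by gcongr
      _ = 10 / ε * √n * Real.log N := by rw [hl]; field_simp; ring
  have hRm : ∀ (D : P → ℝ) q, Measurable fun z => D q + R z q :=
    fun D q => (measurable_sum_dotp (pol q)).const_add _
  have hint : ∀ (t : ℕ) (F : P → ℝ), Integrable (fun z => F (lead t z)) μ :=
    fun t F => integrable_comp_argminTie μ (hRm (C t)) F
  have hint' : ∀ (t : ℕ) (F : P → ℝ), Integrable (fun z => F (lead' t z)) μ :=
    fun t F => integrable_comp_argminTie μ (hRm fun q => C t q + g t (pol q (xs t))) F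
  have hpt : ∀ z, ∑ t ∈ Finset.range T, f t (pol (lead t z) (xs t)) ≤
      (∑ t ∈ Finset.range T, (g t (pol (lead t z) (xs t)) - g t (pol (lead' t z) (xs t)))) +
        W z + ∑ t ∈ Finset.range T, f t (pol p (xs t)) := by
    intro z
    obtain ⟨r, -, hr⟩ := Finset.exists_min_image Finset.univ (R z) Finset.univ_nonempty
    have hbtl := be_the_leader_optimistic (fun t q => f t (pol q (xs t)))
      (fun t q => Q t (pol q (xs t))) (R z) (fun t => lead t z) (fun t => lead' t z) r
      (fun q => hr q (Finset.mem_univ q))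
      (fun t q => argminTie_le (fun q => C t q + R z q) q)
      (fun t q => by
        have h := argminTie_le (fun q => C t q + g t (pol q (xs t)) + R z q) q
        simp only [hC, hg] at h
        simp only [hlead', hC, hg]
        linarith) T p
    have hWr : R z p - R z r ≤ W z := le_of_exp_sum hl0 c (fun q => R z p - R z q) r
    have hsplit : ∑ t ∈ Finset.range T, f t (pol (lead t z) (xs t)) =
        (∑ t ∈ Finset.range T, (g t (pol (lead t z) (xs t)) - g t (pol (lead' t z) (xs t)))) +
        ∑ t ∈ Finset.range T, (Q t (pol (lead t z) (xs t)) +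
          (f t (pol (lead' t z) (xs t)) - Q t (pol (lead' t z) (xs t)))) := by
      rw [← Finset.sum_add_distrib]
      exact Finset.sum_congr rfl fun t _ => by simp only [hg]; ring
    linarith
  have hdiff : ∀ t, Integrable
      (fun z => g t (pol (lead t z) (xs t)) - g t (pol (lead' t z) (xs t))) μ := fun t =>
    (hint t fun q => g t (pol q (xs t))).sub (hint' t fun q => g t (pol q (xs t)))
  have hstab : ∫ z, ∑ t ∈ Finset.range T,
      (g t (pol (lead t z) (xs t)) - g t (pol (lead' t z) (xs t))) ∂μ ≤
      4 * ε * K * ∑ t ∈ Finset.range T, dualNorm (g t) ^ 2 := by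
    rw [integral_finsetSum _ fun t _ => hdiff t, Finset.mul_sum]
    refine Finset.sum_le_sum fun t _ => ?_
    rw [integral_sub (hint t fun q => g t (pol q (xs t))) (hint' t fun q => g t (pol q (xs t)))]
    exact integral_argminTie_sub_le hε pol (C t) (xs t) (g t)
  have hstabi : Integrable (fun z => ∑ t ∈ Finset.range T,
      (g t (pol (lead t z) (xs t)) - g t (pol (lead' t z) (xs t)))) μ :=
    integrable_finsetSum _ fun t _ => hdiff t
  have hsum : Integrable (fun z => (∑ t ∈ Finset.range T,
      (g t (pol (lead t z) (xs t)) - g t (pol (lead' t z) (xs t)))) + W z) μ := hstabi.add hWi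
  have hmono := integral_mono
    (integrable_finsetSum _ fun t _ => hint t fun q => f t (pol q (xs t)))
    (hsum.add (integrable_const (∑ t ∈ Finset.range T, f t (pol p (xs t))))) hpt
  simp only [Pi.add_apply] at hmono
  rw [integral_add hsum (integrable_const _), integral_add hstabi hWi, integral_const,
    probReal_univ, one_smul] at hmono
  rw [← hd, ← hn]
  linarith
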